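/- Strictly-winning deviation in pure profiles: Suppose n ≥ 2 and Assumptions 1 and 2 hold. Let (π_1,…,π_n) be a profile of incentive-compatible signals and let j ∈ argmax_k v_R(π_k) be such that π_j is not fully informative. Then for every sender i ≠ j there exists an incentive-compatible signal π_i'' of sender i with v_R(π_i'') > v_R(π_k) for all k ≠ i and v_i(π_i'') > v_i(π_j); in particular, under the uniform tie-breaking decision rule, any such profile in which sender j is chosen with probability 1 is not a pure Nash equilibrium. -/

import Mathlib

open Finset

namespace Persuasion

variable {n : ℕ} {A ΩR : Type} {Ω : Fin n → Type}
variable [Fintype A] [Fintype ΩR] [∀ k, Fintype (Ω k)]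
variable [DecidableEq ΩR] [∀ k, DecidableEq (Ω k)]

/-- A signal for sender `k`: a map from `k`'s and the receiver's states to
distributions over messages/actions. -/
def IsSignal {k : Fin n} (π : Ω k × ΩR → A → ℝ) : Prop :=
  (∀ s a, 0 ≤ π s a) ∧ ∀ s, ∑ a, π s a = 1

/-- The joint distribution on `Ω × A` induced by the prior `μ0` and sender `k`'s signal `π`. -/
def jointP (μ0 : ((∀ k, Ω k) × ΩR) → ℝ) {k : Fin n}
    (π : Ω k × ΩR → A → ℝ) (ω : (∀ k, Ω k) × ΩR) (a : A) : ℝ :=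
  μ0 ω * π (ω.1 k, ω.2) a

/-- The probability that the signal `π` is realized as the message `a`. -/
def Pmsg (μ0 : ((∀ k, Ω k) × ΩR) → ℝ) {k : Fin n}
    (π : Ω k × ΩR → A → ℝ) (a : A) : ℝ :=
  ∑ ω, jointP μ0 π ω a

/-- The joint probability that `(ω_i, ω_R) = (ωi, ωR)` and the message is `a`. -/
def margIR (μ0 : ((∀ k, Ω k) × ΩR) → ℝ) {k : Fin n}
    (π : Ω k × ΩR → A → ℝ) (i : Fin n) (ωi : Ω i) (ωR : ΩR) (a : A) : ℝ :=
  ∑ ω ∈ univ.filter (fun ω : (∀ k, Ω k) × ΩR => ω.1 i = ωi ∧ ω.2 = ωR), jointP μ0 π ω a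

/-- The joint probability that `ω_i = ωi` and the message is `a`. -/
def margI (μ0 : ((∀ k, Ω k) × ΩR) → ℝ) {k : Fin n}
    (π : Ω k × ΩR → A → ℝ) (i : Fin n) (ωi : Ω i) (a : A) : ℝ :=
  ∑ ω ∈ univ.filter (fun ω : (∀ k, Ω k) × ΩR => ω.1 i = ωi), jointP μ0 π ω a

/-- The joint probability that `ω_R = ωR` and the message is `a`. -/
def margR (μ0 : ((∀ k, Ω k) × ΩR) → ℝ) {k : Fin n}
    (π : Ω k × ΩR → A → ℝ) (ωR : ΩR) (a : A) : ℝ :=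
  ∑ ω ∈ univ.filter (fun ω : (∀ k, Ω k) × ΩR => ω.2 = ωR), jointP μ0 π ω a

/-- The posterior probability of `(ω_i, ω_R) = (ωi, ωR)` given that the message is `a`. -/
noncomputable def posterior (μ0 : ((∀ k, Ω k) × ΩR) → ℝ) {k : Fin n}
    (π : Ω k × ΩR → A → ℝ) (i : Fin n) (ωi : Ω i) (ωR : ΩR) (a : A) : ℝ :=
  margIR μ0 π i ωi ωR a / Pmsg μ0 π a

/-- `E[u_R(b, ω_R) | π = a]`. -/
noncomputable def condExpR (μ0 : ((∀ k, Ω k) × ΩR) → ℝ) {k : Fin n}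
    (π : Ω k × ΩR → A → ℝ) (uR : A → ΩR → ℝ) (a b : A) : ℝ :=
  (∑ ω, jointP μ0 π ω a * uR b ω.2) / Pmsg μ0 π a

/-- Incentive compatibility: each realized message `a` is an optimal action for the
receiver given the posterior it induces. -/
def IC (μ0 : ((∀ k, Ω k) × ΩR) → ℝ) {k : Fin n}
    (π : Ω k × ΩR → A → ℝ) (uR : A → ΩR → ℝ) : Prop :=
  ∀ a, 0 < Pmsg μ0 π a → ∀ b, condExpR μ0 π uR a b ≤ condExpR μ0 π uR a a

/-- The receiver's expected utility `E[u_R(a, ω_R)]` from following the signal `π`. -/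
def vR (μ0 : ((∀ k, Ω k) × ΩR) → ℝ) {k : Fin n}
    (π : Ω k × ΩR → A → ℝ) (uR : A → ΩR → ℝ) : ℝ :=
  ∑ a, ∑ ω, jointP μ0 π ω a * uR a ω.2

/-- Sender `i`'s expected utility `E[u_i(a, ω_i)]` when the receiver follows signal `π`
(of sender `k`). -/
def vS (μ0 : ((∀ k, Ω k) × ΩR) → ℝ) {k : Fin n}
    (π : Ω k × ΩR → A → ℝ) (i : Fin n) (ui : A → Ω i → ℝ) : ℝ :=
  ∑ a, ∑ ω, jointP μ0 π ω a * ui a (ω.1 i)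

/-- The set of maximizers of `u` over `A`. -/
noncomputable def argmaxSet (u : A → ℝ) : Finset A :=
  univ.filter (fun a => ∀ b, u b ≤ u a)

/-- A signal is fully informative if any realized message `a`, in any receiver state `ωR`
that has positive probability jointly with `a`, is the receiver's unique optimal action. -/
noncomputable def FullyInformative (μ0 : ((∀ k, Ω k) × ΩR) → ℝ) {k : Fin n}
    (π : Ω k × ΩR → A → ℝ) (uR : A → ΩR → ℝ) : Prop :=
  ∀ a ωR, 0 < margR μ0 π ωR a → argmaxSet (fun b => uR b ωR) = {a}

/-- Assumption 1: every player has a unique optimal action in each of his states. -/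
noncomputable def Assumption1 (uR : A → ΩR → ℝ) (u : ∀ k : Fin n, A → Ω k → ℝ) : Prop :=
  (∀ ωR, (argmaxSet (fun a => uR a ωR)).card = 1) ∧
  ∀ (k : Fin n) (ωk : Ω k), (argmaxSet (fun a => u k a ωk)).card = 1

/-- Assumption 2: conditional on any positive-probability `(ω_j, ω_R)`, any other sender `i`
has, with positive probability, a state in which his preferences agree with the receiver's. -/
noncomputable def Assumption2 (μ0 : ((∀ k, Ω k) × ΩR) → ℝ) (uR : A → ΩR → ℝ)
    (u : ∀ k : Fin n, A → Ω k → ℝ) : Prop :=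
  ∀ i j : Fin n, i ≠ j → ∀ (ωj : Ω j) (ωR : ΩR),
    (0 < ∑ ω ∈ univ.filter (fun ω : (∀ k, Ω k) × ΩR => ω.1 j = ωj ∧ ω.2 = ωR), μ0 ω) →
    ∃ ωi : Ω i,
      (0 < ∑ ω ∈ univ.filter
        (fun ω : (∀ k, Ω k) × ΩR => ω.1 i = ωi ∧ ω.1 j = ωj ∧ ω.2 = ωR), μ0 ω) ∧
      argmaxSet (fun a => u i a ωi) = argmaxSet (fun a => uR a ωR)

/-- `E_{μ0}[max_{a ∈ A} u_R(a, ω_R)]`: the receiver's first-best expected utility. -/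
noncomputable def Emax [Nonempty A] (μ0 : ((∀ k, Ω k) × ΩR) → ℝ) (uR : A → ΩR → ℝ) : ℝ :=
  ∑ ω : (∀ k, Ω k) × ΩR, μ0 ω * univ.sup' univ_nonempty (fun a => uR a ω.2)

/-- The set of senders whose signals the receiver weakly prefers to all others. -/
noncomputable def BestSet (μ0 : ((∀ k, Ω k) × ΩR) → ℝ)
    (π : ∀ k : Fin n, Ω k × ΩR → A → ℝ) (uR : A → ΩR → ℝ) : Finset (Fin n) :=
  univ.filter (fun j => ∀ k, vR μ0 (π k) uR ≤ vR μ0 (π j) uR)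

/-- Sender `i`'s expected payoff under the uniform tie-breaking decision rule. -/
noncomputable def senderPayoff (μ0 : ((∀ k, Ω k) × ΩR) → ℝ)
    (π : ∀ k : Fin n, Ω k × ΩR → A → ℝ) (uR : A → ΩR → ℝ)
    (i : Fin n) (ui : A → Ω i → ℝ) : ℝ :=
  (∑ j ∈ BestSet μ0 π uR, vS μ0 (π j) i ui) / (BestSet μ0 π uR).card

/-- A pure Nash equilibrium of the persuasion game with the uniform tie-breaking rule. -/
noncomputable def PureNE (μ0 : ((∀ k, Ω k) × ΩR) → ℝ)
    (π : ∀ k : Fin n, Ω k × ΩR → A → ℝ) (uR : A → ΩR → ℝ)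
    (u : ∀ k : Fin n, A → Ω k → ℝ) : Prop :=
  (∀ k, IsSignal (π k) ∧ IC μ0 (π k) uR) ∧
  ∀ (i : Fin n) (π' : Ω i × ΩR → A → ℝ), IsSignal π' → IC μ0 π' uR →
    senderPayoff μ0 (Function.update π i π') uR i (u i) ≤ senderPayoff μ0 π uR i (u i)


/-- An optimal decision rule: for each profile of IC signals, a distribution over senders
supported on senders whose signals the receiver weakly prefers to all others. -/
def IsOptimalRule (μ0 : ((∀ k, Ω k) × ΩR) → ℝ) (uR : A → ΩR → ℝ)
    (D : (∀ k : Fin n, Ω k × ΩR → A → ℝ) → Fin n → ℝ) : Prop :=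
  ∀ π : ∀ k : Fin n, Ω k × ΩR → A → ℝ,
    (∀ k, IsSignal (π k) ∧ IC μ0 (π k) uR) →
    (∀ j, 0 ≤ D π j) ∧ (∑ j, D π j = 1) ∧
    ∀ i, 0 < D π i → ∀ j, vR μ0 (π j) uR ≤ vR μ0 (π i) uR

/-- Sender `i`'s expected payoff from profile `π` under decision rule `D`. -/
def payoffUnder (μ0 : ((∀ k, Ω k) × ΩR) → ℝ)
    (D : (∀ k : Fin n, Ω k × ΩR → A → ℝ) → Fin n → ℝ)
    (π : ∀ k : Fin n, Ω k × ΩR → A → ℝ) (i : Fin n) (ui : A → Ω i → ℝ) : ℝ :=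
  ∑ j, D π j * vS μ0 (π j) i ui

/-- A pure pessimistic Nash equilibrium: a profile of IC signals together with an optimal
decision rule `D` such that every unilateral IC deviation of a sender is unprofitable under
*some* optimal decision rule after the deviation. -/
def PessimisticNE (μ0 : ((∀ k, Ω k) × ΩR) → ℝ)
    (π : ∀ k : Fin n, Ω k × ΩR → A → ℝ) (uR : A → ΩR → ℝ)
    (u : ∀ k : Fin n, A → Ω k → ℝ)
    (D : (∀ k : Fin n, Ω k × ΩR → A → ℝ) → Fin n → ℝ) : Prop :=
  (∀ k, IsSignal (π k) ∧ IC μ0 (π k) uR) ∧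
  IsOptimalRule μ0 uR D ∧
  ∀ (i : Fin n) (π' : Ω i × ΩR → A → ℝ), IsSignal π' → IC μ0 π' uR →
    ∃ D', IsOptimalRule μ0 uR D' ∧
      payoffUnder μ0 D' (Function.update π i π') i (u i) ≤ payoffUnder μ0 D π i (u i)

set_option linter.unusedSectionVars false

lemma jointP_nonneg {μ0 : ((∀ k, Ω k) × ΩR) → ℝ} (hμ0 : ∀ ω, 0 ≤ μ0 ω) {k : Fin n}
    {π : Ω k × ΩR → A → ℝ} (hπ : IsSignal π) (ω : (∀ k, Ω k) × ΩR) (a : A) :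
    0 ≤ jointP μ0 π ω a :=
  mul_nonneg (hμ0 ω) (hπ.1 _ a)

lemma margIR_nonneg {μ0 : ((∀ k, Ω k) × ΩR) → ℝ} (hμ0 : ∀ ω, 0 ≤ μ0 ω) {k : Fin n}
    {π : Ω k × ΩR → A → ℝ} (hπ : IsSignal π) (i : Fin n) (x : Ω i) (r : ΩR) (a : A) :
    0 ≤ margIR μ0 π i x r a :=
  sum_nonneg fun ω _ => jointP_nonneg hμ0 hπ ω a

lemma margR_nonneg {μ0 : ((∀ k, Ω k) × ΩR) → ℝ} (hμ0 : ∀ ω, 0 ≤ μ0 ω) {k : Fin n}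
    {π : Ω k × ΩR → A → ℝ} (hπ : IsSignal π) (r : ΩR) (a : A) :
    0 ≤ margR μ0 π r a :=
  sum_nonneg fun ω _ => jointP_nonneg hμ0 hπ ω a

lemma sum_jointP_mul_eq_sum_margIR (μ0 : ((∀ k, Ω k) × ΩR) → ℝ) {k : Fin n}
    (π : Ω k × ΩR → A → ℝ) (i : Fin n) (a : A) (f : Ω i → ΩR → ℝ) :
    ∑ ω, jointP μ0 π ω a * f (ω.1 i) ω.2 =
      ∑ s : Ω i × ΩR, margIR μ0 π i s.1 s.2 a * f s.1 s.2 := by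
  rw [← sum_fiberwise univ (fun ω : (∀ k, Ω k) × ΩR => (ω.1 i, ω.2))]
  refine sum_congr rfl fun s _ => ?_
  rw [margIR, sum_mul]
  refine sum_congr (by ext ω; simp [Prod.ext_iff]) fun ω hω => ?_
  simp only [mem_filter, mem_univ, true_and] at hω
  rw [hω.1, hω.2]

lemma sum_jointP_mul_eq_sum_margR (μ0 : ((∀ k, Ω k) × ΩR) → ℝ) {k : Fin n}
    (π : Ω k × ΩR → A → ℝ) (a : A) (f : ΩR → ℝ) :
    ∑ ω, jointP μ0 π ω a * f ω.2 = ∑ r, margR μ0 π r a * f r := by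
  rw [← sum_fiberwise univ (fun ω : (∀ k, Ω k) × ΩR => ω.2)]
  refine sum_congr rfl fun r _ => ?_
  rw [margR, sum_mul]
  refine sum_congr rfl fun ω hω => ?_
  simp only [mem_filter, mem_univ, true_and] at hω
  rw [hω]

/-- Incentive compatibility without conditioning: deviating from message `a` to action `b`
gains nothing against the unnormalized posterior. -/
lemma ic_iff {μ0 : ((∀ k, Ω k) × ΩR) → ℝ} (hμ0 : ∀ ω, 0 ≤ μ0 ω) {k : Fin n}
    {π : Ω k × ΩR → A → ℝ} (hπ : IsSignal π) (uR : A → ΩR → ℝ) :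
    IC μ0 π uR ↔ ∀ a b, 0 ≤ ∑ ω, jointP μ0 π ω a * (uR a ω.2 - uR b ω.2) := by
  simp only [mul_sub, sum_sub_distrib, sub_nonneg]
  refine forall_congr' fun a => ?_
  have hP : 0 ≤ Pmsg μ0 π a := sum_nonneg fun ω _ => jointP_nonneg hμ0 hπ ω a
  rcases hP.eq_or_lt with h | h
  · have h0 : ∀ ω, jointP μ0 π ω a = 0 := fun ω =>
      (sum_eq_zero_iff_of_nonneg fun ω _ => jointP_nonneg hμ0 hπ ω a).1 h.symm ω (mem_univ ω)
    simp [← h, h0]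
  · simp only [h, forall_const, condExpR, div_le_div_iff_of_pos_right h]

/-- A nonnegative function on `Ω i × ΩR × A` with the right marginal on `Ω i × ΩR` is the joint
law of `(ω_i, ω_R)` and the message for some signal of sender `i`. -/
lemma exists_signal_margIR_eq [Nonempty A] {μ0 : ((∀ k, Ω k) × ΩR) → ℝ}
    (i : Fin n) (m : Ω i → ΩR → A → ℝ) (hm : ∀ x r a, 0 ≤ m x r a)
    (hsum : ∀ x r, ∑ a, m x r a =
      ∑ ω ∈ univ.filter (fun ω : (∀ k, Ω k) × ΩR => ω.1 i = x ∧ ω.2 = r), μ0 ω) :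
    ∃ π : Ω i × ΩR → A → ℝ, IsSignal π ∧ ∀ x r a, margIR μ0 π i x r a = m x r a := by
  classical
  obtain ⟨a₀⟩ := ‹Nonempty A›
  refine ⟨fun s a => if ∑ b, m s.1 s.2 b = 0 then (if a = a₀ then 1 else 0) else
    m s.1 s.2 a / ∑ b, m s.1 s.2 b, ⟨fun s a => ?_, fun s => ?_⟩, fun x r a => ?_⟩
  · have := sum_nonneg fun b (_ : b ∈ univ) => hm s.1 s.2 b
    have := hm s.1 s.2 a
    dsimp only
    split_ifs <;> positivity
  · by_cases h : ∑ b, m s.1 s.2 b = 0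
    · simp [h]
    · simp [h, ← sum_div]
  · have hfib : ∀ c : Ω i × ΩR → ℝ,
        ∑ ω ∈ univ.filter (fun ω : (∀ k, Ω k) × ΩR => ω.1 i = x ∧ ω.2 = r),
          μ0 ω * c (ω.1 i, ω.2) = (∑ b, m x r b) * c (x, r) := fun c => by
      rw [hsum, sum_mul]
      refine sum_congr rfl fun ω hω => ?_
      simp only [mem_filter, mem_univ, true_and] at hω
      rw [hω.1, hω.2]
    unfold margIR jointP
    rw [hfib (fun s => if ∑ b, m s.1 s.2 b = 0 then (if a = a₀ then 1 else 0) else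
      m s.1 s.2 a / ∑ b, m s.1 s.2 b)]
    by_cases h : ∑ b, m x r b = 0
    · rw [h, zero_mul, (sum_eq_zero_iff_of_nonneg fun b _ => hm x r b).1 h a (mem_univ a)]
    · simp only [h, if_false]
      exact mul_div_cancel₀ _ h

lemma sum_margIR {μ0 : ((∀ k, Ω k) × ΩR) → ℝ} {k : Fin n}
    {π : Ω k × ΩR → A → ℝ} (hπ : IsSignal π) (i : Fin n) (x : Ω i) (r : ΩR) :
    ∑ a, margIR μ0 π i x r a =
      ∑ ω ∈ univ.filter (fun ω : (∀ k, Ω k) × ΩR => ω.1 i = x ∧ ω.2 = r), μ0 ω := by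
  unfold margIR jointP
  rw [sum_comm]
  simp only [← mul_sum, hπ.2, mul_one]

lemma lt_of_argmaxSet_eq_singleton {f : A → ℝ} {t b : A} (h : argmaxSet f = {t}) (hb : b ≠ t) :
    f b < f t := by
  have ht : t ∈ argmaxSet f := by simp [h]
  simp only [argmaxSet, mem_filter, mem_univ, true_and] at ht
  refine (ht b).lt_of_ne fun he => hb ?_
  have : b ∈ argmaxSet f := by
    simp only [argmaxSet, mem_filter, mem_univ, true_and]
    exact fun c => he ▸ ht c
  simpa [h] using this

lemma le_of_argmaxSet_eq_singleton {f : A → ℝ} {t : A} (h : argmaxSet f = {t}) (b : A) :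
    f b ≤ f t := by
  rcases eq_or_ne b t with rfl | hb
  · exact le_rfl
  · exact (lt_of_argmaxSet_eq_singleton h hb).le

/-- Given the message `a` of sender `j` and a receiver state compatible with it, some state of
sender `i` compatible with both makes sender `i` agree with the receiver. -/
lemma exists_aligned_state {μ0 : ((∀ k, Ω k) × ΩR) → ℝ} (hμ0 : ∀ ω, 0 ≤ μ0 ω)
    {uR : A → ΩR → ℝ} {u : ∀ k : Fin n, A → Ω k → ℝ} (hA2 : Assumption2 μ0 uR u)
    {i j : Fin n} (hij : i ≠ j) {π : Ω j × ΩR → A → ℝ} (hπ : IsSignal π)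
    {r : ΩR} {a : A} (hr : 0 < margR μ0 π r a) :
    ∃ x : Ω i, 0 < margIR μ0 π i x r a ∧
      argmaxSet (fun b => u i b x) = argmaxSet (fun b => uR b r) := by
  obtain ⟨ω, hω, hpos⟩ : ∃ ω ∈ univ.filter (fun ω : (∀ k, Ω k) × ΩR => ω.2 = r),
      0 < jointP μ0 π ω a := by
    by_contra! hcon
    exact hr.not_ge (sum_nonpos hcon)
  simp only [mem_filter, mem_univ, true_and] at hω
  subst hω
  have hμω : 0 < μ0 ω := (hμ0 ω).lt_of_ne fun h => by simp [jointP, ← h] at hpos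
  have hπω : 0 < π (ω.1 j, ω.2) a := pos_of_mul_pos_right hpos (hμ0 ω)
  obtain ⟨x, hx, harg⟩ := hA2 i j hij (ω.1 j) ω.2
    (sum_pos' (fun ω' _ => hμ0 ω') ⟨ω, by simp, hμω⟩)
  refine ⟨x, ?_, harg⟩
  obtain ⟨ω', hω', hprior⟩ : ∃ ω' ∈ univ.filter
      (fun ω' : (∀ k, Ω k) × ΩR => ω'.1 i = x ∧ ω'.1 j = ω.1 j ∧ ω'.2 = ω.2), 0 < μ0 ω' := by
    by_contra! hcon
    exact hx.not_ge (sum_nonpos hcon)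
  simp only [mem_filter, mem_univ, true_and] at hω'
  refine sum_pos' (fun ω' _ => jointP_nonneg hμ0 hπ ω' a) ⟨ω', by simp [hω'.1, hω'.2.2], ?_⟩
  unfold jointP
  rw [hω'.2.1, hω'.2.2]
  exact mul_pos hprior hπω

/-- Sender `i` can mimic `π`, except that a small fraction of the message `a`, distributed over
receiver states exactly as the posterior after `a`, is replaced by the receiver's optimal action
in states where sender `i` agrees with it. -/
lemma exists_improving_signal [Nonempty A] [∀ k, Nonempty (Ω k)]
    {μ0 : ((∀ k, Ω k) × ΩR) → ℝ} (hμ0 : ∀ ω, 0 ≤ μ0 ω)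
    {uR : A → ΩR → ℝ} {u : ∀ k : Fin n, A → Ω k → ℝ}
    (hA1 : Assumption1 uR u) (hA2 : Assumption2 μ0 uR u)
    {i j : Fin n} (hij : i ≠ j) {π : Ω j × ΩR → A → ℝ} (hπ : IsSignal π)
    (hIC : IC μ0 π uR) (hnotFI : ¬ FullyInformative μ0 π uR) :
    ∃ π' : Ω i × ΩR → A → ℝ, IsSignal π' ∧ IC μ0 π' uR ∧
      vR μ0 π uR < vR μ0 π' uR ∧ vS μ0 π i (u i) < vS μ0 π' i (u i) := by
  classical
  choose t ht using fun r => card_eq_one.1 (hA1.1 r)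
  unfold FullyInformative at hnotFI
  push Not at hnotFI
  obtain ⟨a, r₀, hr₀, hne⟩ := hnotFI
  have hta : a ≠ t r₀ := fun h => hne (h ▸ ht r₀)
  have hσ : ∀ r, ∃ x : Ω i, 0 < margR μ0 π r a → 0 < margIR μ0 π i x r a ∧
      argmaxSet (fun b => u i b x) = {t r} := fun r => by
    by_cases hr : 0 < margR μ0 π r a
    · obtain ⟨x, hx, hx'⟩ := exists_aligned_state hμ0 hA2 hij hπ hr
      exact ⟨x, fun _ => ⟨hx, hx'.trans (ht r)⟩⟩
    · exact ⟨Classical.arbitrary _, fun h => absurd h hr⟩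
  choose σ hσ using hσ
  obtain ⟨ε, hε0, hε1, hε⟩ : ∃ ε : ℝ, 0 < ε ∧ ε ≤ 1 ∧
      ∀ r, ε * margR μ0 π r a ≤ margIR μ0 π i (σ r) r a := by
    have hev : ∀ᶠ ε : ℝ in nhdsWithin 0 (Set.Ioi 0),
        ∀ r, ε * margR μ0 π r a ≤ margIR μ0 π i (σ r) r a := by
      refine Filter.eventually_all.2 fun r => ?_
      rcases (margR_nonneg hμ0 hπ r a).eq_or_lt with h | h
      · exact Filter.Eventually.of_forall fun ε => by
          rw [← h, mul_zero]
          exact margIR_nonneg hμ0 hπ i _ _ _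
      · filter_upwards [Ioo_mem_nhdsGT (div_pos (hσ r h).1 h)] with ε hε
        exact ((lt_div_iff₀ h).1 hε.2).le
    obtain ⟨ε, h, h'⟩ := (hev.and (Ioo_mem_nhdsGT one_pos)).exists
    exact ⟨ε, h'.1, h'.2.le, h⟩
  set w : ΩR → ℝ := fun r => ε * margR μ0 π r a with hw
  have hw0 : ∀ r, 0 ≤ w r := fun r => mul_nonneg hε0.le (margR_nonneg hμ0 hπ r a)
  obtain ⟨π', hπ', hmarg⟩ := exists_signal_margIR_eq (μ0 := μ0) i
    (fun x r b => margIR μ0 π i x r b + (if x = σ r then w r else 0) *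
      ((if b = t r then 1 else 0) - (if b = a then 1 else 0)))
    (fun x r b => by
      have h1 := margIR_nonneg hμ0 hπ i x r b
      have h2 := hw0 r
      by_cases hx : x = σ r
      · by_cases hb : b = a
        · subst hx hb
          have h3 : w r ≤ margIR μ0 π i (σ r) r b := hε r
          split_ifs <;> linarith
        · simp only [hx, hb, if_true, if_false, sub_zero] at h1 ⊢
          split_ifs <;> linarith
      · simpa [hx] using h1)
    (fun x r => by
      rw [sum_add_distrib, ← mul_sum, sum_sub_distrib, sum_margIR hπ]
      simp)
  have key : ∀ (b : A) (f : Ω i → ΩR → ℝ),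
      ∑ ω, jointP μ0 π' ω b * f (ω.1 i) ω.2 = ∑ ω, jointP μ0 π ω b * f (ω.1 i) ω.2 +
        ∑ r, w r * (((if b = t r then 1 else 0) - (if b = a then 1 else 0)) * f (σ r) r) := by
    intro b f
    rw [sum_jointP_mul_eq_sum_margIR, sum_jointP_mul_eq_sum_margIR]
    simp only [hmarg, add_mul, sum_add_distrib]
    congr 1
    rw [Fintype.sum_prod_type_right]
    refine sum_congr rfl fun r _ => ?_
    simp [ite_mul, mul_assoc]
  have total : ∀ g : A → Ω i → ΩR → ℝ,
      ∑ b, ∑ ω, jointP μ0 π' ω b * g b (ω.1 i) ω.2 =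
        ∑ b, ∑ ω, jointP μ0 π ω b * g b (ω.1 i) ω.2 +
          ∑ r, w r * (g (t r) (σ r) r - g a (σ r) r) := by
    intro g
    simp only [fun b => key b (g b), sum_add_distrib]
    congr 1
    rw [sum_comm]
    refine sum_congr rfl fun r _ => ?_
    rw [← mul_sum]
    simp [sub_mul, sum_sub_distrib]
  have gain : ∀ g : A → Ω i → ΩR → ℝ,
      (∀ r, 0 < margR μ0 π r a → ∀ b, b ≠ t r → g b (σ r) r < g (t r) (σ r) r) →
      0 < ∑ r, w r * (g (t r) (σ r) r - g a (σ r) r) := by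
    intro g hg
    refine sum_pos' (fun r _ => ?_)
      ⟨r₀, mem_univ _, mul_pos (mul_pos hε0 hr₀) (sub_pos.2 (hg r₀ hr₀ a hta))⟩
    rcases (margR_nonneg hμ0 hπ r a).eq_or_lt with h | h
    · simp [hw, ← h]
    · refine mul_nonneg (hw0 r) (sub_nonneg.2 ?_)
      rcases eq_or_ne a (t r) with hat | hat
      · rw [← hat]
      · exact (hg r h a hat).le
  refine ⟨π', hπ', (ic_iff hμ0 hπ' uR).2 fun b c => ?_, ?_, ?_⟩
  · have hold := (ic_iff hμ0 hπ uR).1 hIC b c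
    rw [key b (fun _ r => uR b r - uR c r)]
    simp only [sub_mul, mul_sub (w _), sum_sub_distrib]
    have hgood : 0 ≤ ∑ r, w r * ((if b = t r then 1 else 0) * (uR b r - uR c r)) := by
      refine sum_nonneg fun r _ => mul_nonneg (hw0 r) ?_
      split_ifs with hb
      · rw [one_mul, sub_nonneg, hb]
        exact le_of_argmaxSet_eq_singleton (ht r) c
      · simp
    by_cases hb : b = a
    · subst hb
      have hrem : ∑ r, w r * ((if b = b then 1 else 0) * (uR b r - uR c r)) =
          ε * ∑ ω, jointP μ0 π ω b * (uR b ω.2 - uR c ω.2) := by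
        rw [sum_jointP_mul_eq_sum_margR μ0 π b (fun r => uR b r - uR c r), mul_sum]
        exact sum_congr rfl fun r _ => by simp [hw, mul_assoc]
      rw [hrem]
      nlinarith [mul_nonneg (sub_nonneg.2 hε1) hold]
    · simp only [hb, if_false, zero_mul, mul_zero, sum_const_zero, sub_zero]
      exact add_nonneg hold hgood
  · unfold vR
    rw [total (fun b _ r => uR b r)]
    exact lt_add_of_pos_right _
      (gain (fun b _ r => uR b r) fun r _ b hb => lt_of_argmaxSet_eq_singleton (ht r) hb)
  · unfold vS
    rw [total (fun b x _ => u i b x)]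
    exact lt_add_of_pos_right _
      (gain (fun b x _ => u i b x) fun r hr b hb => lt_of_argmaxSet_eq_singleton (hσ r hr).2 hb)

lemma senderPayoff_of_bestSet_eq_singleton {μ0 : ((∀ k, Ω k) × ΩR) → ℝ}
    {π : ∀ k : Fin n, Ω k × ΩR → A → ℝ} {uR : A → ΩR → ℝ} {j : Fin n}
    (h : BestSet μ0 π uR = {j}) (i : Fin n) (ui : A → Ω i → ℝ) :
    senderPayoff μ0 π uR i ui = vS μ0 (π j) i ui := by
  simp [senderPayoff, h]

lemma bestSet_update_eq_singleton {μ0 : ((∀ k, Ω k) × ΩR) → ℝ}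
    {π : ∀ k : Fin n, Ω k × ΩR → A → ℝ} {uR : A → ΩR → ℝ} {i : Fin n}
    {π' : Ω i × ΩR → A → ℝ} (h : ∀ k, k ≠ i → vR μ0 (π k) uR < vR μ0 π' uR) :
    BestSet μ0 (Function.update π i π') uR = {i} := by
  ext l
  simp only [BestSet, mem_filter, mem_univ, true_and, mem_singleton]
  constructor
  · intro hl
    by_contra hne
    have := hl i
    rw [Function.update_self, Function.update_of_ne hne] at this
    exact this.not_gt (h l hne)
  · rintro rfl k
    rcases eq_or_ne k l with rfl | hk
    · exact le_rfl
    · rw [Function.update_self, Function.update_of_ne hk]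
      exact (h k hk).le

/-- strictly-winning deviation: with at least two senders and under
Assumptions 1 and 2, if in a profile of IC signals the receiver-optimal sender `j` plays a
signal that is not fully informative, then every other sender `i` has an IC deviation that
the receiver strictly prefers to every other sender's signal and that sender `i` strictly
prefers to `π_j`; in particular, if sender `j` is chosen with probability 1 under the uniform
tie-breaking rule, the profile is not a pure Nash equilibrium. -/
theorem strictly_winning_deviation
    [Nonempty A] [Nonempty ΩR] [∀ k, Nonempty (Ω k)]
    (hn : 2 ≤ n)
    (μ0 : ((∀ k, Ω k) × ΩR) → ℝ)
    (hμ0 : ∀ ω, 0 ≤ μ0 ω) (hμ1 : ∑ ω, μ0 ω = 1)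
    (uR : A → ΩR → ℝ) (u : ∀ k : Fin n, A → Ω k → ℝ)
    (hA1 : Assumption1 uR u) (hA2 : Assumption2 μ0 uR u)
    (π : ∀ k : Fin n, Ω k × ΩR → A → ℝ)
    (hprof : ∀ k, IsSignal (π k) ∧ IC μ0 (π k) uR)
    (j : Fin n) (hj : ∀ k, vR μ0 (π k) uR ≤ vR μ0 (π j) uR)
    (hnotFI : ¬ FullyInformative μ0 (π j) uR) :
    (∀ i : Fin n, i ≠ j → ∃ πi'' : Ω i × ΩR → A → ℝ, IsSignal πi'' ∧ IC μ0 πi'' uR ∧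
      (∀ k : Fin n, k ≠ i → vR μ0 (π k) uR < vR μ0 πi'' uR) ∧
      vS μ0 (π j) i (u i) < vS μ0 πi'' i (u i)) ∧
    (BestSet μ0 π uR = {j} → ¬ PureNE μ0 π uR u) := by
  have hdev : ∀ i : Fin n, i ≠ j → ∃ πi'' : Ω i × ΩR → A → ℝ, IsSignal πi'' ∧ IC μ0 πi'' uR ∧
      (∀ k : Fin n, k ≠ i → vR μ0 (π k) uR < vR μ0 πi'' uR) ∧
      vS μ0 (π j) i (u i) < vS μ0 πi'' i (u i) := fun i hij => by
    obtain ⟨π', hπ', hIC', hR, hS⟩ :=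
      exists_improving_signal hμ0 hA1 hA2 hij (hprof j).1 (hprof j).2 hnotFI
    exact ⟨π', hπ', hIC', fun k _ => (hj k).trans_lt hR, hS⟩
  refine ⟨hdev, fun hbest hNE => ?_⟩
  have : Nontrivial (Fin n) := Fin.nontrivial_iff_two_le.2 hn
  obtain ⟨i, hij⟩ := exists_ne j
  obtain ⟨π', hπ', hIC', hR, hS⟩ := hdev i hij
  have hle := hNE.2 i π' hπ' hIC'
  rw [senderPayoff_of_bestSet_eq_singleton hbest,
    senderPayoff_of_bestSet_eq_singleton (bestSet_update_eq_singleton hR),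
    Function.update_self] at hle
  exact hle.not_gt hS

end Persuasion
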